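/- arXiv:2601.12783 — 3 statements merged into one kernel-verified Lean document; each statement's English description precedes it below -/
import Mathlib

section
/- Let A = [aL, aU] be a compact interval with aL < aU, and let u : A × Θ → ℝ be such that a ↦ u(a,θ) is differentiable on [aL, aU] for every θ ∈ Θ. Suppose (i) there exist beliefs pL, pU ∈ Δ_n with aL ∈ A*(pL) and aU ∈ A*(pU), and (ii) for every belief p ∈ Δ_n the set A*(p) is a singleton {a*(p)}. Then for every belief p ∈ Δ_n the function a ↦ u(a,p) is quasi-concave on [aL, aU]. -/
noncomputable section
open Set Finset

/-- The probability simplex over `n+1` states. -/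
def simplex (n : ℕ) : Set (Fin (n + 1) → ℝ) :=
  {p | (∀ i, 0 ≤ p i) ∧ ∑ i, p i = 1}

/-- Expected payoff of action `a` under belief `p`. -/
def expPay {n : ℕ} (u : ℝ → Fin (n + 1) → ℝ) (a : ℝ) (p : Fin (n + 1) → ℝ) : ℝ :=
  ∑ i, p i * u a i

/-- The set of optimal actions in `[aL, aU]` under belief `p`. -/
def argmaxSet {n : ℕ} (u : ℝ → Fin (n + 1) → ℝ) (aL aU : ℝ)
    (p : Fin (n + 1) → ℝ) : Set ℝ :=
  {x ∈ Icc aL aU | ∀ a' ∈ Icc aL aU, expPay u a' p ≤ expPay u x p}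

/-- Berge's maximum theorem for unique maximizers over a compact space. -/
theorem continuous_of_forall_unique_maximizer {K T : Type*} [TopologicalSpace K] [CompactSpace K]
    [TopologicalSpace T] {φ : K → T → ℝ} (hφ : Continuous fun x : K × T => φ x.1 x.2) {α : T → K}
    (hα : ∀ t a, (∀ b, φ b t ≤ φ a t) ↔ a = α t) : Continuous α := by
  refine continuous_iff_isClosed.2 fun C hC => ?_
  have hcl : IsClosed {x : K × T | x.1 ∈ C ∧ ∀ b, φ b x.2 ≤ φ x.1 x.2} := by
    simp only [Set.ofPred_and, Set.ofPred_forall]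
    exact (hC.preimage continuous_fst).inter <| isClosed_iInter fun b => isClosed_le
      (hφ.comp (continuous_const.prodMk continuous_snd)) hφ
  convert isClosedMap_snd_of_compactSpace _ hcl using 1
  ext t
  constructor
  · intro ht
    exact ⟨(α t, t), ⟨ht, (hα t _).2 rfl⟩, rfl⟩
  · rintro ⟨⟨a, s⟩, ⟨ha, hs⟩, rfl⟩
    have h := (hα s a).1 hs
    simpa [← h] using ha

/-- A continuous function on `[0, 1]` with order-connected fibres reflects strict inequalities
between its values above `α 0`. -/
theorem lt_of_apply_lt_of_convex_fibres {α : ℝ → ℝ} (hc : ContinuousOn α (Icc 0 1))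
    (hfib : ∀ r ∈ Icc (0 : ℝ) 1, ∀ s ∈ Icc (0 : ℝ) 1, ∀ t ∈ Icc (0 : ℝ) 1,
      r ≤ s → s ≤ t → α r = α t → α s = α r) {s t : ℝ} (hs : s ∈ Icc (0 : ℝ) 1)
    (ht : t ∈ Icc (0 : ℝ) 1) (h0 : α 0 ≤ α s) (hst : α s < α t) : s < t := by
  by_contra! hts
  obtain ⟨r, hr, hrs⟩ := intermediate_value_Icc ht.1
    (hc.mono (Icc_subset_Icc_right ht.2)) ⟨h0, hst.le⟩
  have := hfib r ⟨hr.1, hr.2.trans ht.2⟩ t ht s hs hr.2 hts hrs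
  linarith

section Segment

variable {aL aU : ℝ} {f g α : ℝ → ℝ}

/-- If `α t` is the unique maximizer over `[aL, aU]` of `(1 - t) f + t g` for each `t ∈ [0, 1]`,
then at each point strictly between `α 0` and `α 1` some mixture of `f` and `g` is stationary,
and `g - f` has nonnegative derivative. -/
theorem exists_stationary_mixture
    (hf : DifferentiableOn ℝ f (Icc aL aU)) (hg : DifferentiableOn ℝ g (Icc aL aU))
    (hα : ∀ t ∈ Icc (0 : ℝ) 1, ∀ a, (a ∈ Icc aL aU ∧ ∀ b ∈ Icc aL aU,
      (1 - t) * f b + t * g b ≤ (1 - t) * f a + t * g a) ↔ a = α t)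
    {y : ℝ} (hy : y ∈ Ioo (α 0) (α 1)) :
    ∃ t ∈ Icc (0 : ℝ) 1, (1 - t) * deriv f y + t * deriv g y = 0 ∧ deriv f y ≤ deriv g y := by
  have hmem : ∀ t ∈ Icc (0 : ℝ) 1, α t ∈ Icc aL aU := fun t ht => ((hα t ht _).2 rfl).1
  have hmax : ∀ t ∈ Icc (0 : ℝ) 1, ∀ b ∈ Icc aL aU,
      (1 - t) * f b + t * g b ≤ (1 - t) * f (α t) + t * g (α t) :=
    fun t ht => ((hα t ht _).2 rfl).2
  have hcont : ContinuousOn α (Icc 0 1) := by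
    let β : Icc (0 : ℝ) 1 → Icc aL aU := fun t => ⟨α t, hmem t t.2⟩
    have hβ : Continuous β := by
      refine continuous_of_forall_unique_maximizer
        (φ := fun (a : Icc aL aU) (t : Icc (0 : ℝ) 1) => (1 - (t : ℝ)) * f a + t * g a)
        (α := β) ?_ ?_
      · have hf' : Continuous fun a : Icc aL aU => f a := hf.continuousOn.domRestrict
        have hg' : Continuous fun a : Icc aL aU => g a := hg.continuousOn.domRestrict
        have ht : Continuous fun x : Icc aL aU × Icc (0 : ℝ) 1 => (x.2 : ℝ) :=
          continuous_subtype_val.comp continuous_snd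
        exact ((continuous_const.sub ht).mul (hf'.comp continuous_fst)).add
          (ht.mul (hg'.comp continuous_fst))
      · intro t a
        have h := hα t t.2 a
        simp only [a.2, true_and] at h
        rw [Subtype.ext_iff, ← h]
        simp only [Subtype.forall]
    exact continuousOn_iff_continuous_domRestrict.2 (continuous_subtype_val.comp hβ)
  have hfib : ∀ r ∈ Icc (0 : ℝ) 1, ∀ s ∈ Icc (0 : ℝ) 1, ∀ t ∈ Icc (0 : ℝ) 1,
      r ≤ s → s ≤ t → α r = α t → α s = α r := by
    intro r hr s hs t ht hrs hst hrt
    refine ((hα s hs _).1 ⟨hmem r hr, fun b hb => ?_⟩).symm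
    have h1 := hmax r hr b hb
    have h2 := hmax t ht b hb
    rw [← hrt] at h2
    rcases hrs.eq_or_lt with rfl | hlt
    · exact h1
    · have h3 := mul_le_mul_of_nonneg_left h1 (sub_nonneg.2 hst)
      have h4 := mul_le_mul_of_nonneg_left h2 (sub_nonneg.2 hrs)
      have h5 : 0 < t - r := by linarith
      refine le_of_mul_le_mul_left ?_ h5
      linarith
  have h0 : (0 : ℝ) ∈ Icc (0 : ℝ) 1 := by simp
  have h1 : (1 : ℝ) ∈ Icc (0 : ℝ) 1 := by simp
  have hsurj := intermediate_value_Icc zero_le_one hcont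
  have hmono : MonotoneOn (fun a => g a - f a) (Icc (α 0) (α 1)) := by
    intro a ha b hb hab
    rcases hab.eq_or_lt with rfl | hab
    · exact le_rfl
    obtain ⟨s, hs, rfl⟩ := hsurj ha
    obtain ⟨t, ht, rfl⟩ := hsurj hb
    have hst := lt_of_apply_lt_of_convex_fibres hcont hfib hs ht ha.1 hab
    have h3 := hmax s hs _ (hmem t ht)
    have h4 := hmax t ht _ (hmem s hs)
    refine le_of_mul_le_mul_left ?_ (sub_pos.2 hst)
    linarith
  have hnhds : Icc aL aU ∈ nhds y :=
    Icc_mem_nhds ((hmem 0 h0).1.trans_lt hy.1) (hy.2.trans_le (hmem 1 h1).2)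
  have hfy := hf.differentiableAt hnhds
  have hgy := hg.differentiableAt hnhds
  obtain ⟨t, ht, hty⟩ := hsurj (Ioo_subset_Icc_self hy)
  refine ⟨t, ht, ?_, ?_⟩
  · have hloc : IsLocalMax (fun a => (1 - t) * f a + t * g a) y := by
      filter_upwards [hnhds] with b hb
      simpa only [hty] using hmax t ht b hb
    exact hloc.hasDerivAt_eq_zero
      ((hfy.hasDerivAt.const_mul (1 - t)).add (hgy.hasDerivAt.const_mul t))
  · have h := hmono.derivWithin_nonneg (x := y)
    rw [derivWithin_of_mem_nhds (Icc_mem_nhds hy.1 hy.2),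
      (hgy.hasDerivAt.fun_sub hfy.hasDerivAt).deriv] at h
    linarith

theorem antitoneOn_and_monotoneOn_of_unique_maximizer
    (hf : DifferentiableOn ℝ f (Icc aL aU)) (hg : DifferentiableOn ℝ g (Icc aL aU))
    (hα : ∀ t ∈ Icc (0 : ℝ) 1, ∀ a, (a ∈ Icc aL aU ∧ ∀ b ∈ Icc aL aU,
      (1 - t) * f b + t * g b ≤ (1 - t) * f a + t * g a) ↔ a = α t) :
    AntitoneOn f (Icc (α 0) (α 1)) ∧ MonotoneOn g (Icc (α 0) (α 1)) := by
  have hsub : Icc (α 0) (α 1) ⊆ Icc aL aU :=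
    Icc_subset_Icc ((hα 0 (by simp) _).2 rfl).1.1 ((hα 1 (by simp) _).2 rfl).1.2
  constructor
  · refine antitoneOn_of_deriv_nonpos (convex_Icc _ _) (hf.continuousOn.mono hsub)
      (hf.mono (interior_subset.trans hsub)) fun y hy => ?_
    rw [interior_Icc] at hy
    obtain ⟨t, ht, h, hle⟩ := exists_stationary_mixture hf hg hα hy
    nlinarith [mul_le_mul_of_nonneg_left hle ht.1]
  · refine monotoneOn_of_deriv_nonneg (convex_Icc _ _) (hg.continuousOn.mono hsub)
      (hg.mono (interior_subset.trans hsub)) fun y hy => ?_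
    rw [interior_Icc] at hy
    obtain ⟨t, ht, h, hle⟩ := exists_stationary_mixture hf hg hα hy
    nlinarith [mul_le_mul_of_nonneg_left hle (sub_nonneg.2 ht.2)]

end Segment

theorem expPay_mix {n : ℕ} (u : ℝ → Fin (n + 1) → ℝ) (a t : ℝ) (p q : Fin (n + 1) → ℝ) :
    expPay u a ((1 - t) • p + t • q) = (1 - t) * expPay u a p + t * expPay u a q := by
  simp only [expPay, Finset.mul_sum, ← Finset.sum_add_distrib]
  refine Finset.sum_congr rfl fun i _ => ?_
  simp only [Pi.add_apply, Pi.smul_apply, smul_eq_mul]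
  ring

theorem mix_mem_simplex {n : ℕ} {p q : Fin (n + 1) → ℝ} (hp : p ∈ simplex n) (hq : q ∈ simplex n)
    {t : ℝ} (ht : t ∈ Icc (0 : ℝ) 1) : (1 - t) • p + t • q ∈ simplex n :=
  convex_stdSimplex ℝ (Fin (n + 1)) hp hq (sub_nonneg.2 ht.2) ht.1 (by ring)

/-- Between the optimal actions of `p` and `q`, the expected payoff decreases under `p` and
increases under `q`. -/
theorem antitoneOn_and_monotoneOn_expPay {n : ℕ} {aL aU : ℝ} {u : ℝ → Fin (n + 1) → ℝ}
    (hdiff : ∀ θ : Fin (n + 1), DifferentiableOn ℝ (fun x => u x θ) (Icc aL aU))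
    (hsing : ∀ p ∈ simplex n, ∃ astar : ℝ, argmaxSet u aL aU p = {astar})
    {p q : Fin (n + 1) → ℝ} (hp : p ∈ simplex n) (hq : q ∈ simplex n) {a b : ℝ}
    (ha : a ∈ argmaxSet u aL aU p) (hb : b ∈ argmaxSet u aL aU q) :
    AntitoneOn (fun x => expPay u x p) (Icc a b) ∧
      MonotoneOn (fun x => expPay u x q) (Icc a b) := by
  have hd : ∀ r : Fin (n + 1) → ℝ, DifferentiableOn ℝ (fun x => expPay u x r) (Icc aL aU) :=
    fun r => DifferentiableOn.fun_sum fun i _ => (hdiff i).const_mul (r i)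
  have hex : ∀ t : ℝ, ∃ c, t ∈ Icc (0 : ℝ) 1 →
      argmaxSet u aL aU ((1 - t) • p + t • q) = {c} := by
    intro t
    by_cases ht : t ∈ Icc (0 : ℝ) 1
    · obtain ⟨c, hc⟩ := hsing _ (mix_mem_simplex hp hq ht)
      exact ⟨c, fun _ => hc⟩
    · exact ⟨0, fun h => absurd h ht⟩
  choose α hα using hex
  have h0 : a = α 0 := by
    have h := hα 0 (by simp)
    rw [sub_zero, one_smul, zero_smul, add_zero] at h
    rwa [h] at ha
  have h1 : b = α 1 := by
    have h := hα 1 (by simp)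
    rw [sub_self, one_smul, zero_smul, zero_add] at h
    rwa [h] at hb
  rw [h0, h1]
  refine antitoneOn_and_monotoneOn_of_unique_maximizer (hd p) (hd q) fun t ht c => ?_
  rw [← Set.mem_singleton_iff, ← hα t ht]
  simp only [argmaxSet, expPay_mix, Set.mem_ofPred_eq]

/-- with action space `A = [aL, aU]` and payoffs differentiable in
the action, if both endpoints are optimal under some beliefs and the set of
optimal actions is a singleton under every belief, then the expected payoff is
quasi-concave in the action under every belief. -/
theorem stmt2 {n : ℕ} (aL aU : ℝ) (hA : aL < aU) (u : ℝ → Fin (n + 1) → ℝ)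
    (hdiff : ∀ θ : Fin (n + 1), DifferentiableOn ℝ (fun x => u x θ) (Icc aL aU))
    (hL : ∃ pL ∈ simplex n, aL ∈ argmaxSet u aL aU pL)
    (hU : ∃ pU ∈ simplex n, aU ∈ argmaxSet u aL aU pU)
    (hsing : ∀ p ∈ simplex n, ∃ astar : ℝ, argmaxSet u aL aU p = {astar}) :
    ∀ p ∈ simplex n, ∀ x ∈ Icc aL aU, ∀ y ∈ Icc aL aU, ∀ z ∈ Icc aL aU,
      x ≤ y → y ≤ z → min (expPay u x p) (expPay u z p) ≤ expPay u y p := by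
  obtain ⟨pL, hpL, hL⟩ := hL
  obtain ⟨pU, hpU, hU⟩ := hU
  intro p hp x hx y hy z hz hxy hyz
  obtain ⟨m, hm⟩ := hsing p hp
  have hmp : m ∈ argmaxSet u aL aU p := hm ▸ Set.mem_singleton m
  rcases le_total y m with h | h
  · exact (min_le_left _ _).trans ((antitoneOn_and_monotoneOn_expPay hdiff hsing hpL hp hL hmp).2
      ⟨hx.1, hxy.trans h⟩ ⟨hy.1, h⟩ hxy)
  · exact (min_le_right _ _).trans ((antitoneOn_and_monotoneOn_expPay hdiff hsing hp hpU hmp hU).1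
      ⟨h, hy.2⟩ ⟨h.trans hyz, hz.2⟩ hyz)
end
end

section
/- Let A = [aL, aU] be a compact interval with aL < aU, and let u : A × Θ → ℝ be such that a ↦ u(a,θ) is differentiable on [aL, aU] for every θ ∈ Θ and attains a maximum over [aL, aU] for every θ ∈ Θ. Suppose the decision problem is quasi-concave: for every belief p ∈ Δ_n, the function a ↦ u(a,p) is quasi-concave on [aL, aU]. Then there exists a permutation σ of {0,…,n} such that for every a ∈ [aL, aU], the vector (∂u(a, θ_{σ(0)})/∂a, …, ∂u(a, θ_{σ(n)})/∂a) is quasi-monotone, i.e., whenever j < l and ∂u(a, θ_{σ(j)})/∂a > 0, also ∂u(a, θ_{σ(l)})/∂a ≥ 0. -/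
noncomputable section
open Set Finset

/-- A positive derivative at `a` of a quasi-concave function on `[c, d]` forces every maximizer
`m` to satisfy `a < m` or to be the right endpoint. -/
lemma lt_or_eq_right_of_derivWithin_pos {f : ℝ → ℝ} {c d m a : ℝ}
    (hf : DifferentiableOn ℝ f (Icc c d))
    (hq : ∀ x ∈ Icc c d, ∀ y ∈ Icc c d, ∀ z ∈ Icc c d, x ≤ y → y ≤ z → min (f x) (f z) ≤ f y)
    (hm : m ∈ Icc c d) (hmax : ∀ x ∈ Icc c d, f x ≤ f m) (ha : a ∈ Icc c d)
    (hpos : 0 < derivWithin f (Icc c d) a) : a < m ∨ m = d := by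
  by_contra! h
  have hsub : Icc m d ⊆ Icc c d := Icc_subset_Icc_left hm.1
  have hanti : AntitoneOn f (Icc m d) := fun x hx y hy hxy => by
    have h1 := hq m hm x (hsub hx) y (hsub hy) hx.1 hxy
    rwa [min_eq_right (hmax y (hsub hy))] at h1
  have hmd : m < d := lt_of_le_of_ne hm.2 h.2
  have heq := derivWithin_subset hsub (uniqueDiffOn_Icc hmd a ⟨h.1, ha.2⟩) (hf a ha)
  have := hanti.derivWithin_nonpos (x := a)
  linarith

/-- A negative derivative at `a` of a quasi-concave function on `[c, d]` forces every maximizer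
`m` to satisfy `m < a` or to be the left endpoint. -/
lemma lt_or_eq_left_of_derivWithin_neg {f : ℝ → ℝ} {c d m a : ℝ}
    (hf : DifferentiableOn ℝ f (Icc c d))
    (hq : ∀ x ∈ Icc c d, ∀ y ∈ Icc c d, ∀ z ∈ Icc c d, x ≤ y → y ≤ z → min (f x) (f z) ≤ f y)
    (hm : m ∈ Icc c d) (hmax : ∀ x ∈ Icc c d, f x ≤ f m) (ha : a ∈ Icc c d)
    (hneg : derivWithin f (Icc c d) a < 0) : m < a ∨ m = c := by
  by_contra! h
  have hsub : Icc c m ⊆ Icc c d := Icc_subset_Icc_right hm.2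
  have hmono : MonotoneOn f (Icc c m) := fun x hx y hy hxy => by
    have h1 := hq x (hsub hx) y (hsub hy) m hm hxy hy.2
    rwa [min_eq_left (hmax x (hsub hx))] at h1
  have hcm : c < m := lt_of_le_of_ne hm.1 h.2.symm
  have heq := derivWithin_subset hsub (uniqueDiffOn_Icc hcm a ⟨ha.1, h.1⟩) (hf a ha)
  have := hmono.derivWithin_nonneg (x := a)
  linarith

lemma single_mem_simplex {n : ℕ} (θ : Fin (n + 1)) : Pi.single θ (1 : ℝ) ∈ simplex n :=
  ⟨fun i => (Pi.single_nonneg.2 zero_le_one : (0 : Fin (n + 1) → ℝ) ≤ Pi.single θ 1) i, by simp⟩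

lemma expPay_single {n : ℕ} (u : ℝ → Fin (n + 1) → ℝ) (a : ℝ) (θ : Fin (n + 1)) :
    expPay u a (Pi.single θ 1) = u a θ := by
  simp [expPay, Pi.single_apply]

/-- with action space `A = [aL, aU]`, payoffs differentiable in
the action and attaining a maximum in every state, if the decision problem is
quasi-concave then after relabeling the states by some permutation `σ`, the
vector of partial derivatives `(∂u(a, θ_{σ(0)})/∂a, …, ∂u(a, θ_{σ(n)})/∂a)` is
quasi-monotone for every action `a ∈ [aL, aU]`. -/
theorem stmt5 {n : ℕ} (aL aU : ℝ) (hA : aL < aU) (u : ℝ → Fin (n + 1) → ℝ)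
    (hdiff : ∀ θ : Fin (n + 1), DifferentiableOn ℝ (fun x => u x θ) (Icc aL aU))
    (hmax : ∀ θ : Fin (n + 1), ∃ m ∈ Icc aL aU, ∀ x ∈ Icc aL aU, u x θ ≤ u m θ)
    (hqcc : ∀ p ∈ simplex n, ∀ x ∈ Icc aL aU, ∀ y ∈ Icc aL aU, ∀ z ∈ Icc aL aU,
      x ≤ y → y ≤ z → min (expPay u x p) (expPay u z p) ≤ expPay u y p) :
    ∃ σ : Equiv.Perm (Fin (n + 1)), ∀ a ∈ Icc aL aU, ∀ j l : Fin (n + 1), j < l →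
      0 < derivWithin (fun x => u x (σ j)) (Icc aL aU) a →
      0 ≤ derivWithin (fun x => u x (σ l)) (Icc aL aU) a := by
  choose m hm hle using hmax
  have hq : ∀ θ, ∀ x ∈ Icc aL aU, ∀ y ∈ Icc aL aU, ∀ z ∈ Icc aL aU, x ≤ y → y ≤ z →
      min (u x θ) (u z θ) ≤ u y θ := fun θ => by
    simpa only [expPay_single] using hqcc _ (single_mem_simplex θ)
  refine ⟨Tuple.sort m, fun a ha j l hjl hpos => ?_⟩
  by_contra! hneg
  have hsort : m (Tuple.sort m j) ≤ m (Tuple.sort m l) := Tuple.monotone_sort m hjl.le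
  have hj := lt_or_eq_right_of_derivWithin_pos (hdiff _) (hq _) (hm _) (hle _) ha hpos
  have hl := lt_or_eq_left_of_derivWithin_neg (hdiff _) (hq _) (hm _) (hle _) ha hneg
  rcases hj with hj | hj <;> rcases hl with hl | hl <;> linarith [ha.1, ha.2]
end
end

section
/- Let A = [aL, aU] be a compact interval with aL ≤ aU, and let u : ℝ × Θ → ℝ be such that a ↦ u(a,θ) is continuous on [aL, aU] for every θ ∈ Θ. Then the set K := {a ∈ [aL, aU] : there exists p ∈ Δ_n with u(a,p) ≥ u(a',p) for all a' ∈ [aL, aU]} of actions that are optimal under some belief is nonempty and compact. -/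
noncomputable section
open Set Finset

theorem simplex_eq_stdSimplex (n : ℕ) : simplex n = stdSimplex ℝ (Fin (n + 1)) := rfl

theorem isCompact_simplex (n : ℕ) : IsCompact (simplex n) := by
  rw [simplex_eq_stdSimplex]
  exact isCompact_stdSimplex ℝ _

theorem simplex_nonempty (n : ℕ) : (simplex n).Nonempty :=
  ⟨_, single_mem_stdSimplex ℝ (0 : Fin (n + 1))⟩

theorem continuous_expPay_belief {n : ℕ} (u : ℝ → Fin (n + 1) → ℝ) (a : ℝ) :
    Continuous (expPay u a) := by
  unfold expPay
  fun_prop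

theorem continuousOn_expPay {n : ℕ} {s : Set ℝ} {u : ℝ → Fin (n + 1) → ℝ}
    (hu : ∀ θ, ContinuousOn (fun x => u x θ) s) (t : Set (Fin (n + 1) → ℝ)) :
    ContinuousOn (fun z : ℝ × (Fin (n + 1) → ℝ) => expPay u z.1 z.2) (s ×ˢ t) := by
  unfold expPay
  refine continuousOn_finsetSum _ fun i _ => ContinuousOn.mul (by fun_prop) ?_
  exact (hu i).comp continuousOn_fst fun z hz => hz.1

/-- On a compact action set, the graph of the optimal-action correspondence is compact. -/
theorem isCompact_optimal_graph {n : ℕ} {s : Set ℝ} (hs : IsCompact s)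
    {u : ℝ → Fin (n + 1) → ℝ} (hu : ∀ θ, ContinuousOn (fun x => u x θ) s) :
    IsCompact {z ∈ s ×ˢ simplex n | ∀ a' ∈ s, expPay u a' z.2 ≤ expPay u z.1 z.2} := by
  have hc : IsCompact (s ×ˢ simplex n) := hs.prod (isCompact_simplex n)
  have hclosed : IsClosed (⋂ a' ∈ s,
      {z ∈ s ×ˢ simplex n | expPay u a' z.2 ≤ expPay u z.1 z.2}) :=
    isClosed_biInter fun a' _ => hc.isClosed.isClosed_le
      ((continuous_expPay_belief u a').comp continuous_snd).continuousOn
      (continuousOn_expPay hu _)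
  convert hc.inter_right hclosed using 1
  ext z
  simp only [mem_ofPred_eq, mem_inter_iff, mem_iInter]
  grind

/-- with action space `A = [aL, aU]` and payoffs continuous in
the action, the set `K` of actions that are optimal under some belief is
nonempty and compact. -/
theorem stmt15 {n : ℕ} (aL aU : ℝ) (hA : aL ≤ aU) (u : ℝ → Fin (n + 1) → ℝ)
    (hcont : ∀ θ : Fin (n + 1), ContinuousOn (fun x => u x θ) (Icc aL aU)) :
    ({x ∈ Icc aL aU | ∃ p ∈ simplex n,
        ∀ a' ∈ Icc aL aU, expPay u a' p ≤ expPay u x p}).Nonempty ∧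
    IsCompact {x ∈ Icc aL aU | ∃ p ∈ simplex n,
        ∀ a' ∈ Icc aL aU, expPay u a' p ≤ expPay u x p} := by
  constructor
  · obtain ⟨p, hp⟩ := simplex_nonempty n
    have hp_cont : ContinuousOn (fun x => expPay u x p) (Icc aL aU) :=
      (continuousOn_expPay hcont (simplex n)).comp
        (f := fun x : ℝ => (x, p)) (by fun_prop) fun x hx => ⟨hx, hp⟩
    obtain ⟨x, hx, hmax⟩ := isCompact_Icc.exists_isMaxOn (nonempty_Icc.2 hA) hp_cont
    exact ⟨x, hx, p, hp, fun a' ha' => hmax ha'⟩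
  · convert (isCompact_optimal_graph isCompact_Icc hcont).image continuous_fst using 1
    ext x
    constructor
    · rintro ⟨hx, p, hp, hopt⟩
      exact ⟨(x, p), ⟨⟨hx, hp⟩, hopt⟩, rfl⟩
    · rintro ⟨⟨x, p⟩, ⟨⟨hx, hp⟩, hopt⟩, rfl⟩
      exact ⟨hx, p, hp, hopt⟩
end
end
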